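/- Let A = KQ/I be a bound quiver algebra, d a dimension vector, and θ ∈ Z^{Q_0} an integral weight whose induced character χ_θ of GL(d) is nontrivial (equivalently, the restriction of θ to the support of d is nonzero). Let G_θ be the kernel of χ_θ, and let C be a θ-semistable, GL(d)-invariant, irreducible, closed subvariety of rep(A,d). Then the invariant ring K[C]^{G_θ} decomposes as ⊕_{n≥0} SI(C)_{nθ}; in particular, SI(C)_{nθ} = 0 for every integer n < 0. -/

import Mathlib

/-! Framework: finite quivers, relations, bound quiver algebras (presented by a quiver
with relations), representation varieties with their Zariski topology, and base change
group actions. -/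

/-- A finite quiver: finite vertex and arrow sets with source and target maps. -/
structure QuiverData where
  V : Type
  A : Type
  [fintypeV : Fintype V]
  [fintypeA : Fintype A]
  [decEqV : DecidableEq V]
  [decEqA : DecidableEq A]
  src : A → V
  tgt : A → V

attribute [instance] QuiverData.fintypeV QuiverData.fintypeA QuiverData.decEqV QuiverData.decEqA

/-- Arrows from `x` to `y` in a `QuiverData`. -/
instance (Q : QuiverData) : Quiver Q.V :=
  ⟨fun x y => {a : Q.A // Q.src a = x ∧ Q.tgt a = y}⟩

/-- The underlying vector space of the path algebra `KQ`: finitely supported functions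
on the set of all paths of `Q`. -/
abbrev PathVect (Q : QuiverData) (K : Type) [Field K] : Type :=
  (Σ x y : Q.V, Quiver.Path x y) →₀ K

/-- A set of relations for `Q` over `K`: each relation is a linear combination of
parallel paths (same source `x` and same target `y`), recorded as a finitely supported
function `Quiver.Path x y →₀ K`. -/
abbrev RelSet (Q : QuiverData) (K : Type) [Field K] : Type :=
  Set (Σ x y : Q.V, Quiver.Path x y →₀ K)

/-- `u · ρ · v`: sandwiching a relation `ρ` (a combination of paths from `x` to `y`)
between paths `u : w ⟶ x` and `v : y ⟶ z`, viewed in the path algebra. -/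
noncomputable def sandwich {Q : QuiverData} {K : Type} [Field K] {w x y z : Q.V}
    (u : Quiver.Path w x) (ρ : Quiver.Path x y →₀ K) (v : Quiver.Path y z) :
    PathVect Q K :=
  ρ.sum fun p c => Finsupp.single ⟨w, z, (u.comp p).comp v⟩ c

/-- The two-sided ideal `⟨R⟩` of the path algebra `KQ` generated by a set of
relations `R`: the `K`-span of all elements `u · ρ · v` with `ρ ∈ R` and `u`, `v`
paths (possibly trivial). -/
noncomputable def relIdeal (Q : QuiverData) (K : Type) [Field K] (R : RelSet Q K) :
    Submodule K (PathVect Q K) :=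
  Submodule.span K { e | ∃ (x y : Q.V) (ρ : Quiver.Path x y →₀ K),
    Sigma.mk x ⟨y, ρ⟩ ∈ R ∧ ∃ (w z : Q.V) (u : Quiver.Path w x) (v : Quiver.Path y z),
      e = sandwich u ρ v }

/-- A path, viewed as an element of the path algebra, lies in the ideal `⟨R⟩`. -/
noncomputable def pathInIdeal (Q : QuiverData) (K : Type) [Field K] (R : RelSet Q K)
    {x y : Q.V} (p : Quiver.Path x y) : Prop :=
  Finsupp.single (⟨x, y, p⟩ : Σ x y : Q.V, Quiver.Path x y) 1 ∈ relIdeal Q K R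

/-- The length-two path given by an arrow `a` followed by an arrow `b`
(written `ba` in the composition conventions of the paper). -/
def path2 (Q : QuiverData) (a b : Q.A) (h : Q.tgt a = Q.src b) :
    Quiver.Path (Q.src a) (Q.tgt b) :=
  (Quiver.Hom.toPath (⟨a, rfl, rfl⟩ : (Q.src a) ⟶ (Q.tgt a))).cons
    (⟨b, h.symm, rfl⟩ : (Q.tgt a) ⟶ (Q.tgt b))

/-- (SB1): every vertex has at most two incoming and at most two outgoing arrows. -/
def SB1 (Q : QuiverData) : Prop :=
  ∀ v : Q.V, Fintype.card {a : Q.A // Q.tgt a = v} ≤ 2 ∧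
    Fintype.card {a : Q.A // Q.src a = v} ≤ 2

/-- (SB2): for every arrow `a` there is at most one arrow `b` with `ba ∉ ⟨R⟩`
and at most one arrow `c` with `ac ∉ ⟨R⟩` (in the notation of the paper, at most one
`b` with `ab ∉ ⟨R⟩` and at most one `c` with `ca ∉ ⟨R⟩`). -/
def SB2 (Q : QuiverData) (K : Type) [Field K] (R : RelSet Q K) : Prop :=
  ∀ a : Q.A,
    {b : Q.A | ∃ h : Q.tgt a = Q.src b, ¬ pathInIdeal Q K R (path2 Q a b h)}.Subsingleton ∧
    {c : Q.A | ∃ h : Q.tgt c = Q.src a, ¬ pathInIdeal Q K R (path2 Q c a h)}.Subsingleton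

/-- The ideal `⟨R⟩` is admissible: it contains all sufficiently long paths and is
contained in the span of paths of length at least two. -/
noncomputable def IsAdmissible (Q : QuiverData) (K : Type) [Field K] (R : RelSet Q K) : Prop :=
  (∃ N : ℕ, ∀ (x y : Q.V) (p : Quiver.Path x y), N ≤ p.length → pathInIdeal Q K R p) ∧
    relIdeal Q K R ≤
      Finsupp.supported K K {q : Σ x y : Q.V, Quiver.Path x y | 2 ≤ q.2.2.length}

/-- The data `(Q, R)` presents a special biserial bound quiver algebra `A = KQ/⟨R⟩`. -/
noncomputable def IsSpecialBiserial (Q : QuiverData) (K : Type) [Field K]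
    (R : RelSet Q K) : Prop :=
  SB1 Q ∧ SB2 Q K R ∧ IsAdmissible Q K R

/-- The affine space of `d`-dimensional representations of the quiver `Q` (with chosen
bases): a matrix `Mat_{d(ta) × d(sa)}(K)` for each arrow `a`. -/
abbrev RepSpace (K : Type) [Field K] (Q : QuiverData) (d : Q.V → ℕ) : Type :=
  ∀ a : Q.A, Matrix (Fin (d (Q.tgt a))) (Fin (d (Q.src a))) K

/-- Casting matrices along equalities of dimensions. -/
def castMat {K : Type} [Field K] {m n m' n' : ℕ} (h1 : m = m') (h2 : n = n')
    (M : Matrix (Fin m) (Fin n) K) : Matrix (Fin m') (Fin n') K :=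
  M.submatrix (Fin.cast h1.symm) (Fin.cast h2.symm)

/-- Evaluation of a representation on a path: the product of the matrices attached to
its arrows. -/
def evalPath {K : Type} [Field K] {Q : QuiverData} {d : Q.V → ℕ} (M : RepSpace K Q d) :
    ∀ {x y : Q.V}, Quiver.Path x y → Matrix (Fin (d y)) (Fin (d x)) K
  | _, _, .nil => 1
  | _, _, .cons p e =>
      (castMat (congrArg d e.2.2) (congrArg d e.2.1) (M e.1)) * evalPath M p

/-- Evaluation of a representation on a relation (a linear combination of parallel
paths). -/
noncomputable def evalRel {K : Type} [Field K] {Q : QuiverData} {d : Q.V → ℕ}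
    (M : RepSpace K Q d) {x y : Q.V} (ρ : Quiver.Path x y →₀ K) :
    Matrix (Fin (d y)) (Fin (d x)) K :=
  ρ.sum fun p c => c • evalPath M p

/-- The representation variety `rep(A,d)` of `A = KQ/⟨R⟩`: representations of `Q`
annihilating all relations in `R`. -/
noncomputable def RepSet (K : Type) [Field K] (Q : QuiverData) (R : RelSet Q K)
    (d : Q.V → ℕ) : Set (RepSpace K Q d) :=
  { M | ∀ (x y : Q.V) (ρ : Quiver.Path x y →₀ K),
      Sigma.mk x ⟨y, ρ⟩ ∈ R → evalRel M ρ = 0 }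

/-- The base change group `GL(d) = ∏_v GL(d(v), K)`. -/
abbrev GLd (K : Type) [Field K] (Q : QuiverData) (d : Q.V → ℕ) : Type :=
  ∀ v : Q.V, GL (Fin (d v)) K

/-- The base change action of `GL(d)` on `rep(Q,d)`. -/
def glAct {K : Type} [Field K] {Q : QuiverData} {d : Q.V → ℕ}
    (g : GLd K Q d) (M : RepSpace K Q d) : RepSpace K Q d :=
  fun a => (g (Q.tgt a) : Matrix (Fin (d (Q.tgt a))) (Fin (d (Q.tgt a))) K) * M a *
    (((g (Q.src a))⁻¹ : GL (Fin (d (Q.src a))) K) :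
      Matrix (Fin (d (Q.src a))) (Fin (d (Q.src a))) K)

open MvPolynomial in
/-- The Zariski topology on the affine space `ι → K`. -/
def zariskiTopology (ι K : Type) [CommSemiring K] : TopologicalSpace (ι → K) :=
  .generateFrom { U | ∃ p : MvPolynomial ι K, U = { x | eval x p ≠ 0 } }

/-- Coordinates on `RepSpace K Q d`. -/
def repCoord {K : Type} [Field K] (Q : QuiverData) (d : Q.V → ℕ) :
    RepSpace K Q d → ((Σ a : Q.A, Fin (d (Q.tgt a)) × Fin (d (Q.src a))) → K) :=
  fun M q => M q.1 q.2.1 q.2.2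

/-- The Zariski topology on `RepSpace K Q d`. -/
def repTopology (K : Type) [Field K] (Q : QuiverData) (d : Q.V → ℕ) :
    TopologicalSpace (RepSpace K Q d) :=
  (zariskiTopology _ K).induced (repCoord Q d)

/-- `θ(e) = ∑_v θ(v) e(v)` for a weight `θ` and a dimension vector `e`. -/
def thetaPair {Q : QuiverData} (θ : Q.V → ℤ) (e : Q.V → ℕ) : ℤ :=
  ∑ v : Q.V, θ v * (e v : ℤ)

/-- A subrepresentation of `M`: a family of subspaces stable under all the arrows. -/
def IsSubrep {K : Type} [Field K] {Q : QuiverData} {d : Q.V → ℕ} (M : RepSpace K Q d)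
    (U : ∀ v : Q.V, Submodule K (Fin (d v) → K)) : Prop :=
  ∀ a : Q.A, (U (Q.src a)).map (Matrix.mulVecLin (M a)) ≤ U (Q.tgt a)

/-- `M` is `θ`-semistable: `θ(dim M) = 0` and `θ(dim M') ≤ 0` for all
subrepresentations `M' ≤ M`. -/
def IsThetaSemistable {K : Type} [Field K] {Q : QuiverData} {d : Q.V → ℕ}
    (θ : Q.V → ℤ) (M : RepSpace K Q d) : Prop :=
  thetaPair θ d = 0 ∧
    ∀ U : ∀ v : Q.V, Submodule K (Fin (d v) → K), IsSubrep M U →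
      (∑ v : Q.V, θ v * (Module.finrank K (U v) : ℤ)) ≤ 0

/-- `M` is `θ`-stable. -/
def IsThetaStable {K : Type} [Field K] {Q : QuiverData} {d : Q.V → ℕ}
    (θ : Q.V → ℤ) (M : RepSpace K Q d) : Prop :=
  (∃ v, d v ≠ 0) ∧ thetaPair θ d = 0 ∧
    ∀ U : ∀ v : Q.V, Submodule K (Fin (d v) → K), IsSubrep M U →
      (∃ v, U v ≠ ⊥) → (∃ v, U v ≠ ⊤) →
      (∑ v : Q.V, θ v * (Module.finrank K (U v) : ℤ)) < 0

/-- The character `χ_θ((g_v)_v) = ∏_v det(g_v)^{θ(v)}` of `GL(d)` attached to an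
integral weight `θ`. -/
noncomputable def chiTheta {K : Type} [Field K] {Q : QuiverData} {d : Q.V → ℕ}
    (θ : Q.V → ℤ) (g : GLd K Q d) : Kˣ :=
  ∏ v : Q.V, (Matrix.GeneralLinearGroup.det (g v)) ^ (θ v)

/-- A function on a subset `C` of the representation space is polynomial (regular):
it is the restriction of a polynomial in the coordinates.  The regular functions
form the coordinate ring `K[C]`. -/
def IsPolyFn {K : Type} [Field K] {Q : QuiverData} {d : Q.V → ℕ}
    {C : Set (RepSpace K Q d)} (f : C → K) : Prop :=
  ∃ p : MvPolynomial (Σ a : Q.A, Fin (d (Q.tgt a)) × Fin (d (Q.src a))) K,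
    ∀ x : C, f x = MvPolynomial.eval (repCoord Q d x) p

/-- The space `SI(C)_{χ_w}` of semi-invariants on `C` of weight `χ_w`, i.e. regular
functions with `g · f = χ_w(g) f` for the action `(g · f)(x) = f(g⁻¹ · x)`. -/
noncomputable def SIwt {K : Type} [Field K] {Q : QuiverData} {d : Q.V → ℕ}
    (C : Set (RepSpace K Q d)) (hC : ∀ g M, M ∈ C → glAct g M ∈ C) (w : Q.V → ℤ) :
    Submodule K (↥C → K) where
  carrier := { f | IsPolyFn f ∧ ∀ (g : GLd K Q d) (x : ↥C),
    f ⟨glAct g ↑x, hC g ↑x x.2⟩ = (((chiTheta w g)⁻¹ : Kˣ) : K) * f x }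
  add_mem' := by
    rintro f₁ f₂ ⟨⟨p₁, hp₁⟩, hf₁⟩ ⟨⟨p₂, hp₂⟩, hf₂⟩
    refine ⟨⟨p₁ + p₂, fun x => ?_⟩, fun g x => ?_⟩
    · simp [hp₁ x, hp₂ x]
    · have := hf₁ g x; have := hf₂ g x
      simp only [Pi.add_apply, *]; ring
  zero_mem' := by
    refine ⟨⟨0, fun x => by simp⟩, fun g x => by simp⟩
  smul_mem' := by
    rintro c f ⟨⟨p, hp⟩, hf⟩
    refine ⟨⟨MvPolynomial.C c * p, fun x => ?_⟩, fun g x => ?_⟩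
    · simp [hp x]
    · have := hf g x
      simp only [Pi.smul_apply, smul_eq_mul, *]; ring

/-- The ring `K[C]^{G_θ}` of regular functions invariant under the kernel `G_θ`
of `χ_θ`, as a submodule of the functions on `C`. -/
noncomputable def invariantFns {K : Type} [Field K] {Q : QuiverData} {d : Q.V → ℕ}
    (C : Set (RepSpace K Q d)) (hC : ∀ g M, M ∈ C → glAct g M ∈ C) (θ : Q.V → ℤ) :
    Submodule K (↥C → K) where
  carrier := { f | IsPolyFn f ∧ ∀ (g : GLd K Q d), chiTheta θ g = 1 → ∀ x : ↥C,
    f ⟨glAct g ↑x, hC g ↑x x.2⟩ = f x }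
  add_mem' := by
    rintro f₁ f₂ ⟨⟨p₁, hp₁⟩, hf₁⟩ ⟨⟨p₂, hp₂⟩, hf₂⟩
    refine ⟨⟨p₁ + p₂, fun x => by simp [hp₁ x, hp₂ x]⟩, fun g hg x => ?_⟩
    have := hf₁ g hg x; have := hf₂ g hg x
    simp only [Pi.add_apply, *]
  zero_mem' := ⟨⟨0, fun x => by simp⟩, fun g hg x => by simp⟩
  smul_mem' := by
    rintro c f ⟨⟨p, hp⟩, hf⟩
    refine ⟨⟨MvPolynomial.C c * p, fun x => by simp [hp x]⟩, fun g hg x => ?_⟩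
    have := hf g hg x
    simp only [Pi.smul_apply, smul_eq_mul, *]

/-- A proper ideal of a finite type algebra over an algebraically closed field lies in the kernel
of some point. -/
theorem exists_algHom_of_ideal_ne_top {K B : Type*} [Field K] [IsAlgClosed K] [CommRing B]
    [Algebra K B] [Algebra.FiniteType K B] (I : Ideal B) (hI : I ≠ ⊤) :
    ∃ φ : B →ₐ[K] K, ∀ b ∈ I, φ b = 0 := by
  obtain ⟨m, hm, hIm⟩ := I.exists_le_maximal hI
  let : Field (B ⧸ m) := Ideal.Quotient.field m
  have : Algebra.FiniteType K (B ⧸ m) :=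
    .of_surjective (Ideal.Quotient.mkₐ K m) (Ideal.Quotient.mkₐ_surjective K m)
  have : Module.Finite K (B ⧸ m) := finite_of_finite_type_of_isJacobsonRing _ _
  let e : K ≃ₐ[K] (B ⧸ m) := AlgEquiv.ofBijective (Algebra.ofId K _)
    IsAlgClosed.algebraMap_bijective_of_isIntegral
  refine ⟨e.symm.toAlgHom.comp (Ideal.Quotient.mkₐ K m), fun b hb => ?_⟩
  have : Ideal.Quotient.mk m b = 0 := Ideal.Quotient.eq_zero_iff_mem.2 (hIm hb)
  simp [this]

open MvPolynomial in
/-- If `x` is a specialization of `ξ`, there is a valuation ring all of whose finite subsets can be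
specialized compatibly with `ξ ↦ x`. -/
theorem exists_valuationSubring_specialization {K F ι : Type*} [Field K] [IsAlgClosed K] [Field F]
    [Algebra K F] [Finite ι] (ξ : ι → F) (x : ι → K)
    (h : ∀ p : MvPolynomial ι K, aeval ξ p = 0 → eval x p = 0) :
    ∃ R : ValuationSubring F, ∀ T : Set F, T.Finite → T ⊆ R →
      ∃ (B : Subalgebra K F) (φ : B →ₐ[K] K), T ⊆ B ∧
        ∀ i, ∃ hi : ξ i ∈ B, φ ⟨ξ i, hi⟩ = x i := by
  let f := (aeval ξ : MvPolynomial ι K →ₐ[K] F).toRingHom.rangeRestrict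
  have hf : Function.Surjective f := RingHom.rangeRestrict_surjective _
  let I := Ideal.map f (RingHom.ker (eval x))
  have hI : I ≠ ⊤ := by
    rw [Ideal.ne_top_iff_one]
    intro h1
    obtain ⟨p, hp, hp1⟩ := (Ideal.mem_map_iff_of_surjective f hf).1 h1
    have h2 : aeval ξ (p - 1) = 0 := by
      have := congrArg Subtype.val hp1
      rw [map_sub, map_one, sub_eq_zero]
      exact this
    have h3 := h _ h2
    rw [RingHom.mem_ker] at hp
    simp [hp] at h3
  obtain ⟨R, hAR, hIR⟩ := Ideal.image_subset_nonunits_valuationSubring I hI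
  refine ⟨R, fun T hT hTR => ?_⟩
  have hξ (i) : ξ i ∈ R := hAR ⟨X i, by simp⟩
  have hK (c : K) : algebraMap K F c ∈ R := hAR ⟨C c, by simp⟩
  let B := Algebra.adjoin K (T ∪ Set.range ξ)
  have hB : ∀ b ∈ B, b ∈ R := by
    intro b hb
    induction hb using Algebra.adjoin_induction with
    | mem b hb => rcases hb with hb | ⟨i, rfl⟩; exacts [hTR hb, hξ i]
    | algebraMap c => exact hK c
    | add a b _ _ ha hb => exact add_mem ha hb
    | mul a b _ _ ha hb => exact mul_mem ha hb
  have : Algebra.FiniteType K B := by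
    rw [← Subalgebra.fg_iff_finiteType]
    exact Subalgebra.fg_def.2 ⟨_, hT.union (Set.finite_range ξ), rfl⟩
  let j : B →+* R := B.val.toRingHom.codRestrict R.toSubring (fun b => hB b b.2)
  let P : Ideal B := (IsLocalRing.maximalIdeal R).comap j
  obtain ⟨φ, hφ⟩ := exists_algHom_of_ideal_ne_top (K := K) P
    (Ideal.IsPrime.ne_top inferInstance)
  refine ⟨B, φ, fun t ht => Algebra.subset_adjoin (.inl ht), fun i =>
    ⟨Algebra.subset_adjoin (.inr ⟨i, rfl⟩), ?_⟩⟩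
  rw [← sub_eq_zero]
  have hmem := hφ (⟨ξ i, Algebra.subset_adjoin (.inr ⟨i, rfl⟩)⟩ - algebraMap K B (x i)) ?_
  · simpa using hmem
  · have := hIR ⟨_, Ideal.mem_map_of_mem f (x := X i - C (x i)) (by simp), rfl⟩
    rw [← R.image_maximalIdeal] at this
    obtain ⟨r, hr, hr'⟩ := this
    refine (?_ : j _ ∈ IsLocalRing.maximalIdeal R)
    convert! hr
    apply Subtype.ext
    rw [hr']
    have : ξ i - algebraMap K F (x i) = aeval ξ (X i - C (x i)) := by simp
    exact this

/-- Over a valuation ring every subspace of `F^n` is moved onto a coordinate subspace by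
an integral invertible matrix. -/
theorem exists_integral_GL_adapted {F : Type*} [Field F] (R : ValuationSubring F) {n : ℕ}
    (U : Submodule F (Fin n → F)) :
    ∃ (g : GL (Fin n) F) (S : Finset (Fin n)), (∀ i j, g.1 i j ∈ R) ∧
      (∀ i j, (g⁻¹).1 i j ∈ R) ∧ ∀ u, u ∈ U ↔ ∀ i ∉ S, (g.1.mulVec u) i = 0 := by
  classical
  let c : (Fin n → R) →ₗ[R] (Fin n → F) := (Algebra.linearMap R F).compLeft (Fin n)
  have hc (w i) : c w i = (w i : F) := rfl
  let L : Submodule R (Fin n → R) := (U.restrictScalars R).comap c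
  have hL (w) : w ∈ L ↔ c w ∈ U := Iff.rfl
  have hcs (r : R) (w) : c (r • w) = (r : F) • c w := by ext i; simp [hc]
  have htf : Module.IsTorsionFree R ((Fin n → R) ⧸ L) := by
    rw [Submodule.isTorsionFree_iff_torsion_eq_bot, eq_bot_iff]
    rintro q ⟨⟨r, hr⟩, hq⟩
    obtain ⟨w, rfl⟩ := L.mkQ_surjective q
    have hr0 : (r : F) ≠ 0 := by simpa using nonZeroDivisors.ne_zero hr
    have h1 : r • w ∈ L := by
      rw [← Submodule.Quotient.mk_eq_zero]
      exact hq
    rw [hL, hcs, U.smul_mem_iff hr0] at h1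
    rw [Submodule.mem_bot]
    exact (Submodule.Quotient.mk_eq_zero _).2 h1
  have : Module.Flat R ((Fin n → R) ⧸ L) := by
    rw [Module.Flat.flat_iff_torsion_eq_bot_of_isBezout]
    rwa [← Submodule.isTorsionFree_iff_torsion_eq_bot]
  have : Module.Free R ((Fin n → R) ⧸ L) := Module.free_of_flat_of_isLocalRing
  obtain ⟨s, hs⟩ := Module.projective_lifting_property L.mkQ LinearMap.id L.mkQ_surjective
  let f : (Fin n → R) →ₗ[R] L := (LinearMap.id - s.comp L.mkQ).codRestrict L fun w => by
    rw [← Submodule.Quotient.mk_eq_zero]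
    have := LinearMap.congr_fun hs (L.mkQ w)
    simp only [LinearMap.comp_apply, LinearMap.id_apply] at this
    simp only [LinearMap.sub_apply, LinearMap.id_apply, LinearMap.comp_apply,
      Submodule.Quotient.mk_sub]
    rw [← Submodule.mkQ_apply, ← Submodule.mkQ_apply, this, sub_self]
  have hf : ∀ w : L, f w = w := fun w => by
    have : (Submodule.Quotient.mk w.1 : (Fin n → R) ⧸ L) = 0 :=
      (Submodule.Quotient.mk_eq_zero _).2 w.2
    apply Subtype.ext
    simp [f, this]
  have hcompl : IsCompl L (LinearMap.ker f) := LinearMap.isCompl_of_proj hf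
  have : Module.Finite R L := .of_surjective f fun w => ⟨w, hf w⟩
  have : Module.Flat R L := by
    rw [Module.Flat.flat_iff_torsion_eq_bot_of_isBezout,
      ← Submodule.isTorsionFree_iff_torsion_eq_bot]
    infer_instance
  have : Module.Free R L := Module.free_of_flat_of_isLocalRing
  let e := Submodule.quotientEquivOfIsCompl _ _ hcompl
  have : Module.Finite R (LinearMap.ker f) := .equiv e
  have : Module.Free R (LinearMap.ker f) := .of_equiv e
  let b₁ := Module.Free.chooseBasis R L
  let b₂ := Module.Free.chooseBasis R (LinearMap.ker f)
  let E := Submodule.prodEquivOfIsCompl _ _ hcompl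
  let b₀ := (b₁.prod b₂).map E
  let τ := b₀.indexEquiv (Pi.basisFun R (Fin n))
  let b := b₀.reindex τ
  let G : GL (Fin n) R := ⟨LinearMap.toMatrix' b.equivFun, LinearMap.toMatrix' b.equivFun.symm,
    by rw [← LinearMap.toMatrix'_comp]; simp, by rw [← LinearMap.toMatrix'_comp]; simp⟩
  have hG (w) : G.1.mulVec w = b.equivFun w := LinearMap.toMatrix'_mulVec _ _
  have hLb (w) : w ∈ L ↔ ∀ i, (τ.symm i).isRight → b.equivFun w i = 0 := by
    rw [← Submodule.prodEquivOfIsCompl_symm_apply_snd_eq_zero _ _ hcompl,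
      ← b₂.repr.map_eq_zero_iff,
      DFunLike.ext_iff, τ.symm.forall_congr_left]
    simp [b, b₀, E]
  refine ⟨Matrix.GeneralLinearGroup.map (algebraMap R F) G,
    Finset.univ.filter fun i => (τ.symm i).isLeft, fun i j => (G.1 i j).2, fun i j => ?_,
    fun u => ?_⟩
  · rw [← map_inv]
    exact ((G⁻¹).1 i j).2
  · obtain ⟨r, hr⟩ := IsLocalization.exist_integer_multiples (nonZeroDivisors R) Finset.univ u
    have hr0 : (r.1 : F) ≠ 0 := by simp
    choose! w hw using hr
    have hcw : c w = (r.1 : F) • u := by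
      ext i
      exact hw i (Finset.mem_univ i)
    have hgw (i) : ((Matrix.GeneralLinearGroup.map (algebraMap R F) G).1.mulVec (c w)) i
        = (b.equivFun w i : F) := by
      rw [← hG]
      simp [Matrix.mulVec, dotProduct, hc]
    rw [← U.smul_mem_iff hr0, ← hcw, ← hL, hLb]
    refine forall_congr' fun i => ?_
    rw [hcw] at hgw
    have hgi := hgw i
    rw [Matrix.mulVec_smul, Pi.smul_apply, smul_eq_mul] at hgi
    have : b.equivFun w i = 0 ↔
        ((Matrix.GeneralLinearGroup.map (algebraMap R F) G).1.mulVec u) i = 0 := by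
      rw [← Subtype.coe_inj, ← hgi]
      simp [hr0]
    rw [this]
    simp

/-- Distinct integral powers are linearly independent characters of `Kˣ`. -/
theorem linearIndependent_zpow_units (K : Type*) [Field K] [CharZero K] :
    LinearIndependent K (fun (k : ℤ) (t : Kˣ) => ((t ^ k : Kˣ) : K)) := by
  let χ : ℤ → (Kˣ →* K) := fun k => (Units.coeHom K).comp (zpowGroupHom k)
  have hχ : Function.Injective χ := by
    intro k l hkl
    have h2 : ((2 : K) ^ k) = 2 ^ l := by
      simpa [χ] using DFunLike.congr_fun hkl (Units.mk0 (2 : K) two_ne_zero)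
    have h3 : ((2 : ℚ) ^ k) = 2 ^ l := (algebraMap ℚ K).injective (by simpa using h2)
    exact zpow_right_injective₀ (by norm_num) (by norm_num) h3
  exact (linearIndependent_monoidHom Kˣ K).comp χ hχ

theorem coeff_eq_zero_of_sum_zpow_mul_eq_zero {K : Type*} [Field K] [CharZero K] (s : Finset ℤ)
    (a : ℤ → K) (h : ∀ t : Kˣ, ∑ k ∈ s, ((t ^ k : Kˣ) : K) * a k = 0) (k : ℤ) (hk : k ∈ s) :
    a k = 0 := by
  refine linearIndependent_iff'.1 (linearIndependent_zpow_units K) s a ?_ k hk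
  ext t
  simpa [mul_comm] using h t

theorem mem_of_sum_zpow_mul_eq {K : Type*} [Field K] [CharZero K] (s : Finset ℤ)
    (a : ℤ → K) (e : ℤ) (b : K) (hb : b ≠ 0)
    (h : ∀ t : Kˣ, ∑ k ∈ s, ((t ^ k : Kˣ) : K) * a k = ((t ^ e : Kˣ) : K) * b) : e ∈ s := by
  by_contra he
  refine hb (neg_eq_zero.1 ?_)
  have := coeff_eq_zero_of_sum_zpow_mul_eq_zero (insert e s) (fun k => if k = e then -b else a k)
    (fun t => ?_) e (Finset.mem_insert_self _ _)
  · simpa using this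
  · rw [Finset.sum_insert he, if_pos rfl,
      Finset.sum_congr rfl fun k hk => by rw [if_neg (ne_of_mem_of_not_mem hk he)], h]
    ring

theorem exists_units_zpow_eq {K : Type*} [Field K] [IsAlgClosed K] {a : ℤ} (ha : a ≠ 0) (u : Kˣ) :
    ∃ s : Kˣ, s ^ a = u := by
  have key (n : ℕ) (hn : 0 < n) (u : Kˣ) : ∃ s : Kˣ, s ^ n = u := by
    obtain ⟨z, hz⟩ := IsAlgClosed.exists_pow_nat_eq (u : K) hn
    have hz0 : z ≠ 0 := by
      rintro rfl
      rw [zero_pow hn.ne'] at hz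
      exact u.ne_zero hz.symm
    exact ⟨Units.mk0 z hz0, Units.ext (by simpa using hz)⟩
  obtain ⟨n, rfl | rfl⟩ := a.eq_nat_or_neg
  · obtain ⟨s, hs⟩ := key n (by omega) u
    exact ⟨s, by simpa using hs⟩
  · obtain ⟨s, hs⟩ := key n (by omega) u⁻¹
    exact ⟨s, by simp [hs]⟩

theorem exists_units_zpow_eq_one_zpow_ne_one {K : Type*} [Field K] [IsAlgClosed K] [CharZero K]
    {a k : ℤ} (ha : a ≠ 0) (hk : ¬ a ∣ k) : ∃ ζ : Kˣ, ζ ^ a = 1 ∧ ζ ^ k ≠ 1 := by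
  have : NeZero a.natAbs := ⟨by omega⟩
  have : NeZero (a.natAbs : K) := ⟨by exact_mod_cast NeZero.ne a.natAbs⟩
  obtain ⟨z, hz⟩ := HasEnoughRootsOfUnity.exists_primitiveRoot K a.natAbs
  obtain ⟨ζ, rfl⟩ := hz.isUnit (NeZero.ne _)
  have hζ : IsPrimitiveRoot ζ a.natAbs := IsPrimitiveRoot.coe_units_iff.1 hz
  have hdvd (l : ℤ) : ζ ^ l = 1 ↔ a ∣ l := by
    rw [hζ.zpow_eq_one_iff_dvd, Int.natAbs_dvd]
  exact ⟨ζ, (hdvd a).2 dvd_rfl, fun h => hk ((hdvd k).1 h)⟩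

open MvPolynomial in
/-- Scaling the coordinates by powers of `t` multiplies each weighted homogeneous component by the
corresponding power of `t`. -/
theorem eval_zpow_mul {K ι : Type*} [Field K] (w : ι → ℤ) (p : MvPolynomial ι K) :
    ∃ s : Finset ℤ, (∀ k ∈ s, ∃ m : ι →₀ ℕ, Finsupp.weight w m = k) ∧
      ∀ (t : Kˣ) (x : ι → K), eval (fun q => ((t ^ w q : Kˣ) : K) * x q) p =
        ∑ k ∈ s, ((t ^ k : Kˣ) : K) * eval x (weightedHomogeneousComponent w k p) := by
  classical
  refine ⟨p.support.image (Finsupp.weight w), fun k hk => ?_, fun t x => ?_⟩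
  · obtain ⟨m, -, hm⟩ := Finset.mem_image.1 hk
    exact ⟨m, hm⟩
  have hmono (m : ι →₀ ℕ) : ∏ i ∈ m.support, (((t ^ w i : Kˣ) : K) * x i) ^ m i =
      ((t ^ (Finsupp.weight w m) : Kˣ) : K) * ∏ i ∈ m.support, x i ^ m i := by
    simp_rw [mul_pow]
    rw [Finset.prod_mul_distrib]
    congr 1
    rw [Finsupp.weight_apply, Finsupp.sum]
    induction m.support using Finset.induction_on with
    | empty => simp
    | insert i s hi ih =>
      rw [Finset.prod_insert hi, Finset.sum_insert hi, ih, zpow_add, Units.val_mul]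
      congr 1
      rw [nsmul_eq_mul, mul_comm, zpow_mul, zpow_natCast, Units.val_pow_eq_pow_val]
  have hsum : p = ∑ k ∈ p.support.image (Finsupp.weight w), weightedHomogeneousComponent w k p := by
    conv_lhs => rw [← sum_weightedHomogeneousComponent w p]
    refine finsum_eq_sum_of_support_subset _ fun k hk => ?_
    by_contra hk'
    refine hk (weightedHomogeneousComponent_eq_zero' k p fun m hm h => hk' ?_)
    simpa using ⟨m, by simpa using hm, h⟩
  conv_lhs => rw [hsum]
  rw [map_sum]
  refine Finset.sum_congr rfl fun k _ => ?_
  rw [eval_eq, eval_eq, Finset.mul_sum]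
  refine Finset.sum_congr rfl fun m hm => ?_
  rw [hmono, (weightedHomogeneousComponent_isWeightedHomogeneous k p) (mem_support_iff.1 hm)]
  ring

section Action

variable {K : Type} [Field K] {Q : QuiverData} {d : Q.V → ℕ}

theorem glAct_mul (g h : GLd K Q d) (M : RepSpace K Q d) :
    glAct (g * h) M = glAct g (glAct h M) := by
  funext a
  simp [glAct, Matrix.mul_assoc]

theorem chiTheta_mul (θ : Q.V → ℤ) (g h : GLd K Q d) :
    chiTheta θ (g * h) = chiTheta θ g * chiTheta θ h := by
  simp [chiTheta, mul_zpow, Finset.prod_mul_distrib]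

theorem chiTheta_inv (θ : Q.V → ℤ) (g : GLd K Q d) :
    chiTheta θ g⁻¹ = (chiTheta θ g)⁻¹ := by
  simp [chiTheta]

theorem chiTheta_zsmul (n : ℤ) (θ : Q.V → ℤ) (g : GLd K Q d) :
    chiTheta (n • θ) g = chiTheta θ g ^ n := by
  simp [chiTheta, ← Finset.prod_zpow, ← zpow_mul, mul_comm]

/-- The one-parameter subgroup of the diagonal torus with weights `c`. -/
def diagTorus (c : ∀ v : Q.V, Fin (d v) → ℤ) (t : Kˣ) : GLd K Q d := fun v =>
  ⟨Matrix.diagonal fun i => ((t ^ c v i : Kˣ) : K),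
    Matrix.diagonal fun i => ((t ^ (-c v i) : Kˣ) : K),
    by
      rw [Matrix.diagonal_mul_diagonal, ← Matrix.diagonal_one]
      congr 1
      funext i
      rw [← Units.val_mul, ← zpow_add]
      simp,
    by
      rw [Matrix.diagonal_mul_diagonal, ← Matrix.diagonal_one]
      congr 1
      funext i
      rw [← Units.val_mul, ← zpow_add]
      simp⟩

theorem chiTheta_diagTorus (θ : Q.V → ℤ) (c : ∀ v : Q.V, Fin (d v) → ℤ) (t : Kˣ) :
    chiTheta θ (diagTorus c t) = t ^ ∑ v, θ v * ∑ i, c v i := by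
  have hsum {ι : Type} (s : Finset ι) (f : ι → ℤ) : t ^ ∑ i ∈ s, f i = ∏ i ∈ s, t ^ f i := by
    classical
    induction s using Finset.induction_on with
    | empty => simp
    | insert i s hi ih => rw [Finset.prod_insert hi, Finset.sum_insert hi, zpow_add, ih]
  rw [chiTheta, hsum]
  refine Finset.prod_congr rfl fun v _ => ?_
  rw [mul_comm, zpow_mul, hsum]
  congr 1
  apply Units.ext
  simp [diagTorus]

/-- The weight of the diagonal torus on a coordinate of the representation space. -/
def torusWeight (c : ∀ v : Q.V, Fin (d v) → ℤ)
    (q : Σ a : Q.A, Fin (d (Q.tgt a)) × Fin (d (Q.src a))) : ℤ :=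
  c _ q.2.1 - c _ q.2.2

theorem repCoord_glAct_diagTorus (c : ∀ v : Q.V, Fin (d v) → ℤ) (t : Kˣ) (M : RepSpace K Q d) :
    repCoord Q d (glAct (diagTorus c t) M) =
      fun q => ((t ^ torusWeight c q : Kˣ) : K) * repCoord Q d M q := by
  funext ⟨a, i, j⟩
  simp only [repCoord, glAct, diagTorus, torusWeight, sub_eq_add_neg, zpow_add, Units.inv_mk,
    Matrix.mul_diagonal, Matrix.diagonal_mul, Units.val_mul]
  ring

/-- `M` is block triangular with respect to the coordinate subspaces given by `S`. -/
def IsBlock (S : ∀ v : Q.V, Finset (Fin (d v))) (M : RepSpace K Q d) : Prop :=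
  ∀ a, ∀ i ∉ S (Q.tgt a), ∀ j ∈ S (Q.src a), M a i j = 0

/-- The subspace mapped by `g` onto the coordinate subspace of `S`. -/
def coordSubmodule {n : ℕ} (g : GL (Fin n) K) (S : Finset (Fin n)) : Submodule K (Fin n → K) where
  carrier := {u | ∀ i ∉ S, g.1.mulVec u i = 0}
  add_mem' hu hw i hi := by simp [Matrix.mulVec_add, hu i hi, hw i hi]
  zero_mem' i hi := by simp
  smul_mem' c u hu i hi := by simp [Matrix.mulVec_smul, hu i hi]

theorem mem_coordSubmodule {n : ℕ} (g : GL (Fin n) K) (S : Finset (Fin n)) (u : Fin n → K) :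
    u ∈ coordSubmodule g S ↔ ∀ i ∉ S, g.1.mulVec u i = 0 := Iff.rfl

theorem finrank_coordSubmodule {n : ℕ} (g : GL (Fin n) K) (S : Finset (Fin n)) :
    Module.finrank K (coordSubmodule g S) = S.card := by
  classical
  let e : (Fin n → K) ≃ₗ[K] (Fin n → K) := Matrix.GeneralLinearGroup.toLin g |>.toLinearEquiv
  have he (u) : e u = g.1.mulVec u := rfl
  let W : Submodule K (Fin n → K) :=
    ⨅ i ∈ (↑S : Set (Fin n))ᶜ, LinearMap.ker (LinearMap.proj i : (Fin n → K) →ₗ[K] K)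
  have hW : W.comap e.toLinearMap = coordSubmodule g S := by
    ext u
    simp [W, mem_coordSubmodule, he]
  rw [← hW, LinearEquiv.finrank_eq (e.ofSubmodule' W),
    LinearEquiv.finrank_eq (LinearMap.iInfKerProjEquiv K (fun _ : Fin n => K)
      (I := (↑S : Set (Fin n))) disjoint_compl_right (by simp))]
  simp

/-- A point conjugate to a block triangular one has a subrepresentation of the block dimension. -/
theorem isSubrep_coordSubmodule {S : ∀ v : Q.V, Finset (Fin (d v))} {M : RepSpace K Q d}
    {g : GLd K Q d} (h : IsBlock S (glAct g M)) :
    IsSubrep M fun v => coordSubmodule (g v) (S v) := by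
  rintro a _ ⟨u, hu, rfl⟩ i hi
  have h1 : (g (Q.tgt a)).1.mulVec ((M a).mulVec u) =
      (glAct g M a).mulVec ((g (Q.src a)).1.mulVec u) := by
    simp [glAct, Matrix.mul_assoc]
  rw [Matrix.mulVecLin_apply, h1]
  rw [Matrix.mulVec, dotProduct]
  refine Finset.sum_eq_zero fun j _ => ?_
  by_cases hj : j ∈ S (Q.src a)
  · rw [h a i hi j hj, zero_mul]
  · rw [hu j hj, mul_zero]

theorem isBlock_glAct_of_isSubrep {S : ∀ v : Q.V, Finset (Fin (d v))} {M : RepSpace K Q d}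
    {g : GLd K Q d} (h : IsSubrep M fun v => coordSubmodule (g v) (S v)) :
    IsBlock S (glAct g M) := by
  intro a i hi j hj
  have hu : (g (Q.src a))⁻¹.1.mulVec (Pi.single j 1) ∈ coordSubmodule (g (Q.src a)) (S _) := by
    intro k hk
    rw [Matrix.mulVec_mulVec, Units.mul_inv, Matrix.one_mulVec,
      Pi.single_eq_of_ne (ne_of_mem_of_not_mem hj hk).symm]
  have := h a ⟨_, hu, rfl⟩ i hi
  rw [Matrix.mulVecLin_apply, Matrix.mulVec_mulVec, Matrix.mulVec_mulVec,
    Matrix.mulVec_single_one] at this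
  exact this

theorem sum_card_nonpos_of_isThetaSemistable {θ : Q.V → ℤ} {M : RepSpace K Q d}
    (hM : IsThetaSemistable θ M) {S : ∀ v : Q.V, Finset (Fin (d v))} {g : GLd K Q d}
    (h : IsBlock S (glAct g M)) : ∑ v, θ v * ((S v).card : ℤ) ≤ 0 := by
  simpa only [finrank_coordSubmodule] using hM.2 _ (isSubrep_coordSubmodule h)

/-- A semi-invariant of negative weight that does not vanish at a point bounds the dimension
vectors of its subrepresentations. -/
theorem sum_card_nonneg_of_mem_SIwt [CharZero K] {C : Set (RepSpace K Q d)}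
    {hC : ∀ g M, M ∈ C → glAct g M ∈ C} {θ : Q.V → ℤ} {n : ℤ} (hn : n < 0) {h : C → K}
    (hh : h ∈ SIwt C hC (n • θ)) {x : C} (hx : h x ≠ 0) {S : ∀ v : Q.V, Finset (Fin (d v))}
    {g : GLd K Q d} (hS : IsBlock S (glAct g x.1)) : 0 ≤ ∑ v, θ v * ((S v).card : ℤ) := by
  classical
  obtain ⟨⟨p, hp⟩, hsi⟩ := hh
  let N : C := ⟨glAct g x, hC g x x.2⟩
  have hN : h N ≠ 0 := by
    rw [hsi g x]
    exact mul_ne_zero (Units.ne_zero _) hx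
  let c : ∀ v : Q.V, Fin (d v) → ℤ := fun v i => if i ∈ S v then 1 else 0
  let w := fun q => max (torusWeight c q) 0
  have hw (t : Kˣ) : repCoord Q d (glAct (diagTorus c t) N.1) =
      fun q => ((t ^ w q : Kˣ) : K) * repCoord Q d N q := by
    rw [repCoord_glAct_diagTorus]
    funext ⟨a, i, j⟩
    by_cases hi : i ∈ S (Q.tgt a) <;> by_cases hj : j ∈ S (Q.src a)
    · simp [w, torusWeight, c, hi, hj]
    · simp [w, torusWeight, c, hi, hj]
    · have : repCoord Q d N.1 ⟨a, i, j⟩ = 0 := hS a i hi j hj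
      simp [this]
    · simp [w, torusWeight, c, hi, hj]
  obtain ⟨s, hs, hsum⟩ := eval_zpow_mul w p
  have hchi (t : Kˣ) : (chiTheta (n • θ) (diagTorus c t : GLd K Q d))⁻¹ =
      t ^ (-n * ∑ v, θ v * ((S v).card : ℤ)) := by
    rw [chiTheta_zsmul, chiTheta_diagTorus, ← zpow_neg, ← zpow_mul, mul_comm]
    simp [c]
  have hmem := mem_of_sum_zpow_mul_eq s _ (-n * ∑ v, θ v * ((S v).card : ℤ)) (h N) hN fun t => by
    rw [← hsum t (repCoord Q d N), ← hw, ← hchi, ← hsi (diagTorus c t) N, hp]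
  obtain ⟨m, hm⟩ := hs _ hmem
  refine nonneg_of_mul_nonneg_right (?_ : 0 ≤ -n * _) (by omega)
  rw [← hm, Finsupp.weight_apply]
  exact Finset.sum_nonneg fun q _ => nsmul_nonneg (le_max_right _ _) _

end Action

section Paths

variable {K : Type} [Field K] {Q : QuiverData} {d : Q.V → ℕ}

theorem evalPath_comp (M : RepSpace K Q d) {x y z : Q.V} (p : Quiver.Path x y)
    (q : Quiver.Path y z) : evalPath M (p.comp q) = evalPath M q * evalPath M p := by
  induction q with
  | nil => simp [evalPath]
  | cons q e ih => rw [Quiver.Path.comp_cons, evalPath, evalPath, ih, Matrix.mul_assoc]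

/-- The arrow `a`, viewed as a path. -/
def arrowPath (a : Q.A) : Quiver.Path (Q.src a) (Q.tgt a) :=
  Quiver.Hom.toPath (⟨a, rfl, rfl⟩ : (Q.src a) ⟶ (Q.tgt a))

theorem evalPath_arrowPath (M : RepSpace K Q d) (a : Q.A) : evalPath M (arrowPath a) = M a := by
  simp only [arrowPath, Quiver.Hom.toPath, evalPath, Matrix.mul_one]
  rfl

/-- Evaluation of a representation on the whole path algebra. -/
noncomputable def evalAlg (M : RepSpace K Q d) :
    PathVect Q K →ₗ[K] (∀ x y : Q.V, Matrix (Fin (d y)) (Fin (d x)) K) :=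
  Finsupp.lsum K fun q => LinearMap.toSpanSingleton K _ (Pi.single q.1 (Pi.single q.2.1
    (evalPath M q.2.2)))

theorem evalAlg_single (M : RepSpace K Q d) {x y : Q.V} (p : Quiver.Path x y) (c : K) :
    evalAlg M (Finsupp.single ⟨x, y, p⟩ c) x y = c • evalPath M p := by
  simp [evalAlg]

theorem evalPath_eq_zero_of_pathInIdeal {R : RelSet Q K} {M : RepSpace K Q d}
    (hM : M ∈ RepSet K Q R d) {x y : Q.V} {p : Quiver.Path x y} (hp : pathInIdeal Q K R p) :
    evalPath M p = 0 := by
  have hker : relIdeal Q K R ≤ LinearMap.ker (evalAlg M) := by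
    refine Submodule.span_le.2 ?_
    rintro _ ⟨x, y, ρ, hρ, w, z, u, v, rfl⟩
    have h0 := hM x y ρ hρ
    have h1 : ∑ q ∈ ρ.support, ρ q • (evalPath M v * (evalPath M q * evalPath M u)) = 0 := by
      have : evalPath M v * (evalRel M ρ * evalPath M u) = 0 := by simp [h0]
      rw [← this, evalRel, Finsupp.sum, Matrix.sum_mul, Matrix.mul_sum]
      simp
    rw [SetLike.mem_coe, LinearMap.mem_ker, sandwich, Finsupp.sum, map_sum]
    have h2 (q : Quiver.Path x y) : evalAlg M (Finsupp.single ⟨w, z, (u.comp q).comp v⟩ (ρ q)) =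
        Pi.single w (Pi.single z (ρ q • (evalPath M v * (evalPath M q * evalPath M u)))) := by
      simp [evalAlg, evalPath_comp, Pi.single_smul, Matrix.mul_assoc]
    simp_rw [h2]
    have h3 := congrArg (fun m => (Pi.single w (Pi.single z m) :
      ∀ x y : Q.V, Matrix (Fin (d y)) (Fin (d x)) K)) h1
    simp only [Pi.single_zero] at h3
    rw [← h3]
    funext x' y'
    by_cases hx : x' = w
    · subst hx
      by_cases hy : y' = z
      · subst hy
        simp
      · simp [Pi.single_eq_of_ne hy]
    · simp [Pi.single_eq_of_ne hx]
  have := evalAlg_single M p 1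
  rw [LinearMap.mem_ker.1 (hker hp)] at this
  simpa using this.symm

/-- The vectors killed by all paths of length at least `i`. -/
def pathAnnihilator (M : RepSpace K Q d) (i : ℕ) (x : Q.V) : Submodule K (Fin (d x) → K) where
  carrier := {u | ∀ (y : Q.V) (p : Quiver.Path x y), i ≤ p.length → (evalPath M p).mulVec u = 0}
  add_mem' hu hw y p hp := by rw [Matrix.mulVec_add, hu y p hp, hw y p hp, add_zero]
  zero_mem' y p hp := Matrix.mulVec_zero _
  smul_mem' c u hu y p hp := by rw [Matrix.mulVec_smul, hu y p hp, smul_zero]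

theorem pathAnnihilator_mono (M : RepSpace K Q d) {i j : ℕ} (hij : i ≤ j) (x : Q.V) :
    pathAnnihilator M i x ≤ pathAnnihilator M j x :=
  fun _ hu y p hp => hu y p (hij.trans hp)

theorem map_pathAnnihilator_succ_le (M : RepSpace K Q d) (i : ℕ) (a : Q.A) :
    (pathAnnihilator M (i + 1) (Q.src a)).map (Matrix.mulVecLin (M a)) ≤
      pathAnnihilator M i (Q.tgt a) := by
  rintro _ ⟨u, hu, rfl⟩ y p hp
  have := hu y ((arrowPath a).comp p) (by
    rw [Quiver.Path.length_comp]
    have : (arrowPath a).length = 1 := rfl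
    omega)
  rwa [evalPath_comp, evalPath_arrowPath, ← Matrix.mulVec_mulVec] at this

/-- A nilpotent representation has two nested subrepresentations that differ exactly at a
prescribed vertex of the support. -/
theorem exists_isSubrep_pair {M : RepSpace K Q d} {N : ℕ}
    (hN : ∀ (x y : Q.V) (p : Quiver.Path x y), N ≤ p.length → evalPath M p = 0)
    {v : Q.V} (hv : d v ≠ 0) :
    ∃ U U' : ∀ x : Q.V, Submodule K (Fin (d x) → K), IsSubrep M U ∧ IsSubrep M U' ∧
      (∀ x ≠ v, U x = U' x) ∧ U v < U' v := by
  have hex : ∃ i, pathAnnihilator M i v ≠ pathAnnihilator M (i + 1) v := by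
    by_contra! hcon
    have hconst (i) : pathAnnihilator M 0 v = pathAnnihilator M i v := by
      induction i with
      | zero => rfl
      | succ i ih => rw [ih, hcon]
    have hbot (u) (hu : u ∈ pathAnnihilator M 0 v) : u = 0 := by
      simpa [evalPath] using hu v .nil le_rfl
    have htop (u) : u ∈ pathAnnihilator M N v := fun y p hp => by rw [hN _ _ p hp]; simp
    have h1 := hbot (fun _ => 1) (hconst N ▸ htop _)
    exact one_ne_zero (congrFun h1 ⟨0, by omega⟩)
  obtain ⟨i, hi⟩ := hex
  have hle (x) := pathAnnihilator_mono M i.le_succ x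
  have hsub (U : ∀ x : Q.V, Submodule K (Fin (d x) → K))
      (h₁ : ∀ x, pathAnnihilator M i x ≤ U x) (h₂ : ∀ x, U x ≤ pathAnnihilator M (i + 1) x) :
      IsSubrep M U := fun a =>
    (Submodule.map_mono (h₂ _)).trans ((map_pathAnnihilator_succ_le M i a).trans (h₁ _))
  refine ⟨pathAnnihilator M i, Function.update (pathAnnihilator M i) v (pathAnnihilator M (i + 1) v),
    hsub _ (fun _ => le_rfl) hle, hsub _ (fun x => ?_) (fun x => ?_), fun x hx => ?_, ?_⟩
  · obtain rfl | hx := eq_or_ne x v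
    · simpa using hle x
    · simp [hx]
  · obtain rfl | hx := eq_or_ne x v
    · simp
    · simpa [hx] using hle x
  · simp [hx]
  · simpa using lt_of_le_of_ne (hle v) hi

/-- The index set of the coordinates on the representation space. -/
abbrev RepIndex (Q : QuiverData) (d : Q.V → ℕ) : Type :=
  Σ a : Q.A, Fin (d (Q.tgt a)) × Fin (d (Q.src a))

/-- The representation with coordinates `ξ`. -/
def repOfCoord {F : Type} (Q : QuiverData) (d : Q.V → ℕ) (ξ : RepIndex Q d → F) :
    ∀ a : Q.A, Matrix (Fin (d (Q.tgt a))) (Fin (d (Q.src a))) F :=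
  fun a => Matrix.of fun i j => ξ ⟨a, i, j⟩

open MvPolynomial in
/-- The entries of a path evaluation are polynomials in the coordinates. -/
theorem exists_evalPath_eq_map {x y : Q.V} (p : Quiver.Path x y) :
    ∃ P : Matrix (Fin (d y)) (Fin (d x)) (MvPolynomial (RepIndex Q d) K),
      ∀ (F : Type) [Field F] [Algebra K F] (ξ : _ → F),
        evalPath (repOfCoord Q d ξ) p = P.map (aeval ξ) := by
  induction p with
  | nil => exact ⟨1, fun F _ _ ξ => by
      rw [evalPath, Matrix.map_one _ (map_zero _) (map_one _)]⟩
  | cons p e ih =>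
    obtain ⟨P, hP⟩ := ih
    obtain ⟨a, rfl, rfl⟩ := e
    let A : Matrix (Fin (d (Q.tgt a))) (Fin (d (Q.src a))) (MvPolynomial (RepIndex Q d) K) :=
      repOfCoord Q d X a
    refine ⟨A * P, fun F _ _ ξ => ?_⟩
    rw [evalPath, hP, Matrix.map_mul]
    congr 1
    ext i j
    simp [castMat, repOfCoord, A]

end Paths

section Semistable

variable {K : Type} [Field K] {Q : QuiverData} {d : Q.V → ℕ}

open MvPolynomial in
/-- Subrepresentations of a generic representation specialize, preserving dimension vectors. -/
theorem exists_isBlock_of_specialization [IsAlgClosed K] {F : Type} [Field F] [Algebra K F]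
    (ξ : RepIndex Q d → F) (x : RepSpace K Q d)
    (hx : ∀ p : MvPolynomial (RepIndex Q d) K, aeval ξ p = 0 → eval (repCoord Q d x) p = 0)
    {U : ∀ v : Q.V, Submodule F (Fin (d v) → F)}
    (hU : IsSubrep (repOfCoord Q d ξ : RepSpace F Q d) U) :
    ∃ (S : ∀ v : Q.V, Finset (Fin (d v))) (g : GLd K Q d),
      (∀ v, (S v).card = Module.finrank F (U v)) ∧ IsBlock S (glAct g x) := by
  obtain ⟨R, hR⟩ := exists_valuationSubring_specialization ξ (repCoord Q d x) hx
  choose g S hg hg' hgU using fun v => exists_integral_GL_adapted R (U v)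
  have hUeq (v) : U v = coordSubmodule (g v) (S v) := by
    ext u
    rw [hgU, mem_coordSubmodule]
  obtain ⟨B, φ, hTB, hφ⟩ := hR
    (Set.range (fun q : Σ v : Q.V, Fin (d v) × Fin (d v) => (g q.1).1 q.2.1 q.2.2) ∪
      Set.range (fun q : Σ v : Q.V, Fin (d v) × Fin (d v) => (g q.1)⁻¹.1 q.2.1 q.2.2))
    ((Set.finite_range _).union (Set.finite_range _)) (by
      rintro _ (⟨q, rfl⟩ | ⟨q, rfl⟩)
      exacts [hg _ _ _, hg' _ _ _])
  have hgB (v i j) : (g v).1 i j ∈ B := hTB (.inl ⟨⟨v, i, j⟩, rfl⟩)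
  have hgB' (v i j) : (g v)⁻¹.1 i j ∈ B := hTB (.inr ⟨⟨v, i, j⟩, rfl⟩)
  choose hξ hφξ using hφ
  have hinj {m n : ℕ} : Function.Injective
      (fun A : Matrix (Fin m) (Fin n) B => A.map (B.val : B → F)) :=
    Matrix.map_injective Subtype.val_injective
  let G (v) : Matrix (Fin (d v)) (Fin (d v)) B := Matrix.of fun i j => ⟨_, hgB v i j⟩
  let G' (v) : Matrix (Fin (d v)) (Fin (d v)) B := Matrix.of fun i j => ⟨_, hgB' v i j⟩
  have hGmap (v) : (G v).map (B.val : B → F) = (g v).1 := by ext; simp [G]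
  have hGmap' (v) : (G' v).map (B.val : B → F) = (g v)⁻¹.1 := by ext; simp [G']
  let γ (v) : GL (Fin (d v)) B := ⟨G v, G' v, hinj (by
      simp only [Matrix.map_mul, hGmap, hGmap', Units.mul_inv]
      rw [Matrix.map_one _ (map_zero _) (map_one _)]), hinj (by
      simp only [Matrix.map_mul, hGmap, hGmap', Units.inv_mul]
      rw [Matrix.map_one _ (map_zero _) (map_one _)])⟩
  let X (a : Q.A) : Matrix (Fin (d (Q.tgt a))) (Fin (d (Q.src a))) B :=
    Matrix.of fun i j => ⟨_, hξ ⟨a, i, j⟩⟩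
  refine ⟨S, fun v => Matrix.GeneralLinearGroup.map φ.toRingHom (γ v), fun v => ?_,
    fun a i hi j hj => ?_⟩
  · rw [hUeq, finrank_coordSubmodule]
  have hblock : glAct g (repOfCoord Q d ξ) a i j = 0 :=
    isBlock_glAct_of_isSubrep (by simpa only [← hUeq] using hU) a i hi j hj
  have h1 : glAct g (repOfCoord Q d ξ) a =
      (G (Q.tgt a) * X a * G' (Q.src a)).map (B.val : B → F) := by
    rw [Matrix.map_mul, Matrix.map_mul, hGmap, hGmap']
    rfl
  have h2 : (G (Q.tgt a) * X a * G' (Q.src a)) i j = 0 := by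
    rw [h1] at hblock
    exact Subtype.val_injective hblock
  have h3 : glAct (fun v => Matrix.GeneralLinearGroup.map φ.toRingHom (γ v)) x a =
      (G (Q.tgt a) * X a * G' (Q.src a)).map φ := by
    have hX : (X a).map φ = x a := by
      ext k l
      exact hφξ ⟨a, k, l⟩
    rw [Matrix.map_mul, Matrix.map_mul, hX, glAct, ← map_inv]
    rfl
  rw [h3, Matrix.map_apply, h2, map_zero]

open MvPolynomial in
theorem isPrime_vanishingIdeal_of_isIrreducible {C : Set (RepSpace K Q d)}
    (hC : @IsIrreducible _ (repTopology K Q d) C) :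
    (vanishingIdeal K (repCoord Q d '' C)).IsPrime := by
  obtain ⟨⟨x, hx⟩, hirr⟩ := hC
  have hopen (p : MvPolynomial (RepIndex Q d) K) :
      @IsOpen _ (repTopology K Q d) {M | eval (repCoord Q d M) p ≠ 0} :=
    ⟨_, TopologicalSpace.isOpen_generateFrom_of_mem ⟨p, rfl⟩, rfl⟩
  refine Ideal.isPrime_iff.2 ⟨fun h => ?_, fun {p q} hpq => ?_⟩
  · have := (Ideal.eq_top_iff_one _).1 h _ ⟨x, hx, rfl⟩
    simp at this
  · by_contra! hcon
    simp only [mem_vanishingIdeal_iff, Set.forall_mem_image, not_forall] at hcon hpq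
    obtain ⟨⟨y, hy, hyp⟩, z, hz, hzq⟩ := hcon
    obtain ⟨w, hw, hwp, hwq⟩ := hirr _ _ (hopen p) (hopen q) ⟨y, hy, hyp⟩ ⟨z, hz, hzq⟩
    have := hpq hw
    rw [map_mul] at this
    exact (mul_ne_zero hwp hwq) this

open MvPolynomial in
theorem SIwt_zsmul_eq_bot [IsAlgClosed K] [CharZero K]
    {R : RelSet Q K} (hadm : IsAdmissible Q K R)
    {θ : Q.V → ℤ} (hθ : ∃ v : Q.V, d v ≠ 0 ∧ θ v ≠ 0)
    {C : Set (RepSpace K Q d)} (hCrep : C ⊆ RepSet K Q R d)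
    (hC : ∀ g M, M ∈ C → glAct g M ∈ C)
    (hCirr : @IsIrreducible _ (repTopology K Q d) C)
    (hss : ∃ M ∈ C, IsThetaSemistable θ M) {n : ℤ} (hn : n < 0) : SIwt C hC (n • θ) = ⊥ := by
  refine (Submodule.eq_bot_iff _).2 fun h hh => ?_
  by_contra hne
  obtain ⟨x, hx⟩ := Function.ne_iff.1 hne
  obtain ⟨M, hMC, hM⟩ := hss
  obtain ⟨v, hdv, hθv⟩ := hθ
  obtain ⟨N, hN⟩ := hadm.1
  let I := vanishingIdeal K (repCoord Q d '' C)
  have : I.IsPrime := isPrime_vanishingIdeal_of_isIrreducible hCirr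
  let F := FractionRing (MvPolynomial (RepIndex Q d) K ⧸ I)
  let ψ : MvPolynomial (RepIndex Q d) K →ₐ[K] F :=
    (IsScalarTower.toAlgHom K (MvPolynomial (RepIndex Q d) K ⧸ I) F).comp (Ideal.Quotient.mkₐ K I)
  let ξ : RepIndex Q d → F := fun q => ψ (X q)
  have hψ : aeval ξ = ψ := (aeval_unique ψ).symm
  have hξ (p) : aeval ξ p = 0 ↔ ∀ y ∈ C, eval (repCoord Q d y) p = 0 := by
    have : ψ p = 0 ↔ p ∈ I := by
      simp [ψ, Ideal.Quotient.eq_zero_iff_mem]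
    rw [hψ, this, mem_vanishingIdeal_iff, Set.forall_mem_image]
    rfl
  have hnil (y z : Q.V) (p : Quiver.Path y z) (hp : N ≤ p.length) :
      evalPath (repOfCoord Q d ξ : RepSpace F Q d) p = 0 := by
    obtain ⟨P, hP⟩ := exists_evalPath_eq_map (K := K) (d := d) p
    rw [hP F ξ]
    ext i j
    refine (hξ _).2 fun y hy => ?_
    have h0 := evalPath_eq_zero_of_pathInIdeal (hCrep hy) (hN _ _ p hp)
    have h1 := hP K (repCoord Q d y)
    rw [show (repOfCoord Q d (repCoord Q d y) : RepSpace K Q d) = y from rfl, h0] at h1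
    exact (congrFun (congrFun h1 i) j).symm
  obtain ⟨U, U', hU, hU', heq, hlt⟩ := exists_isSubrep_pair hnil hdv
  have hzero {W : ∀ v : Q.V, Submodule F (Fin (d v) → F)}
      (hW : IsSubrep (repOfCoord Q d ξ : RepSpace F Q d) W) :
      ∑ v, θ v * (Module.finrank F (W v) : ℤ) = 0 := by
    refine le_antisymm ?_ ?_
    · obtain ⟨S, g, hS, hb⟩ := exists_isBlock_of_specialization ξ M
        (fun p hp => (hξ p).1 hp M hMC) hW
      simpa only [hS] using sum_card_nonpos_of_isThetaSemistable hM hb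
    · obtain ⟨S, g, hS, hb⟩ := exists_isBlock_of_specialization ξ x.1
        (fun p hp => (hξ p).1 hp x x.2) hW
      simpa only [hS] using sum_card_nonneg_of_mem_SIwt hn hh hx hb
  have hdiff := sub_eq_zero.2 ((hzero hU').trans (hzero hU).symm)
  rw [← Finset.sum_sub_distrib, Finset.sum_eq_single v
    (fun w _ hw => by rw [heq w hw, sub_self]) (by simp), ← mul_sub] at hdiff
  have := Submodule.finrank_lt_finrank_of_lt hlt
  rcases mul_eq_zero.1 hdiff with h | h
  · exact hθv h
  · omega

end Semistable

section Decomposition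

variable {K : Type} [Field K] {Q : QuiverData} {d : Q.V → ℕ}

theorem exists_chiTheta_diagTorus {θ : Q.V → ℤ} {v : Q.V} (hv : d v ≠ 0) :
    ∃ c : ∀ v : Q.V, Fin (d v) → ℤ, ∀ t : Kˣ,
      chiTheta θ (diagTorus c t : GLd K Q d) = t ^ θ v := by
  classical
  have : NeZero (d v) := ⟨hv⟩
  refine ⟨Pi.single v (Pi.single 0 1), fun t => ?_⟩
  rw [chiTheta_diagTorus, Finset.sum_eq_single v (fun w _ hw => by simp [Pi.single_eq_of_ne hw])
    (by simp)]
  simp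

theorem SIwt_zsmul_le_invariantFns {C : Set (RepSpace K Q d)}
    (hC : ∀ g M, M ∈ C → glAct g M ∈ C) (θ : Q.V → ℤ) (n : ℤ) :
    SIwt C hC (n • θ) ≤ invariantFns C hC θ := by
  rintro f ⟨hp, hf⟩
  refine ⟨hp, fun g hg x => ?_⟩
  rw [hf, chiTheta_zsmul, hg]
  simp

theorem iSupIndep_SIwt [IsAlgClosed K] [CharZero K] {C : Set (RepSpace K Q d)}
    (hC : ∀ g M, M ∈ C → glAct g M ∈ C) {θ : Q.V → ℤ} (hθ : ∃ v : Q.V, d v ≠ 0 ∧ θ v ≠ 0) :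
    iSupIndep fun n : ℕ => SIwt C hC ((n : ℤ) • θ) := by
  obtain ⟨v, hdv, hθv⟩ := hθ
  obtain ⟨c, hc⟩ := exists_chiTheta_diagTorus (K := K) (θ := θ) hdv
  obtain ⟨t, ht⟩ := exists_units_zpow_eq hθv (Units.mk0 (2 : K) two_ne_zero)
  let g : GLd K Q d := diagTorus c t
  have hg : chiTheta θ g = Units.mk0 (2 : K) two_ne_zero := by rw [hc, ht]
  let T : Module.End K (C → K) := LinearMap.funLeft K K fun x => ⟨glAct g x, hC g x x.2⟩
  have hinj : Function.Injective fun n : ℕ => ((2 : K) ^ n)⁻¹ := by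
    intro m n hmn
    have h1 : (2 : K) ^ m = 2 ^ n := inv_injective hmn
    exact Nat.pow_right_injective le_rfl (by exact_mod_cast h1)
  refine (T.eigenspaces_iSupIndep.comp hinj).mono fun n f hf => ?_
  rw [Function.comp_apply, Module.End.mem_eigenspace_iff]
  funext x
  refine (hf.2 g x).trans ?_
  rw [chiTheta_zsmul, hg]
  simp

open MvPolynomial in
/-- A `G_θ`-invariant function is a sum of semi-invariants of weights `n • θ`, `n ∈ ℤ`. -/
theorem invariantFns_le_iSup_SIwt [IsAlgClosed K] [CharZero K] {C : Set (RepSpace K Q d)}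
    (hC : ∀ g M, M ∈ C → glAct g M ∈ C) {θ : Q.V → ℤ} (hθ : ∃ v : Q.V, d v ≠ 0 ∧ θ v ≠ 0) :
    invariantFns C hC θ ≤ ⨆ n : ℤ, SIwt C hC (n • θ) := by
  rintro f ⟨⟨p, hp⟩, hf⟩
  obtain ⟨v, hdv, ha⟩ := hθ
  obtain ⟨c, hc⟩ := exists_chiTheta_diagTorus (K := K) (θ := θ) hdv
  set a := θ v
  let act (g : GLd K Q d) (x : C) : C := ⟨glAct g x, hC g x x.2⟩
  have act_mul (g h x) : act (g * h) x = act g (act h x) := Subtype.ext (glAct_mul g h x.1)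
  obtain ⟨s, -, hs⟩ := eval_zpow_mul (torusWeight c) p
  let F (k : ℤ) (x : C) : K :=
    eval (repCoord Q d x.1) (weightedHomogeneousComponent (torusWeight c) k p)
  have hF (t x) : f (act (diagTorus c t) x) = ∑ k ∈ s, ((t ^ k : Kˣ) : K) * F k x := by
    rw [hp, repCoord_glAct_diagTorus, hs]
  have hfact {g h : GLd K Q d} (hgh : chiTheta θ g = chiTheta θ h) (x : C) :
      f (act g x) = f (act h x) := by
    have h1 := hf (g * h⁻¹) (by rw [chiTheta_mul, chiTheta_inv, hgh, mul_inv_cancel]) (act h x)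
    rw [← h1]
    change _ = f (act (g * h⁻¹) (act h x))
    rw [← act_mul, inv_mul_cancel_right]
  have hFact (g : GLd K Q d) (r : Kˣ) (hr : r ^ a = chiTheta θ g) (k) (hk : k ∈ s) (x : C) :
      F k (act g x) = ((r ^ k : Kˣ) : K) * F k x := by
    refine sub_eq_zero.1 (coeff_eq_zero_of_sum_zpow_mul_eq_zero s
      (fun k => F k (act g x) - ((r ^ k : Kˣ) : K) * F k x) (fun t => ?_) k hk)
    have h1 : f (act (diagTorus c t) (act g x)) = f (act (diagTorus c (t * r)) x) := by
      rw [← act_mul]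
      refine hfact ?_ x
      rw [chiTheta_mul, hc, hc, mul_zpow, hr]
    rw [hF, hF, ← sub_eq_zero, ← Finset.sum_sub_distrib] at h1
    rw [← h1]
    refine Finset.sum_congr rfl fun k _ => ?_
    rw [mul_zpow, Units.val_mul]
    ring
  have act_one (x) : act 1 x = x := Subtype.ext (by funext b; simp [act, glAct])
  have hFsum : f = ∑ k ∈ s, F k := by
    funext x
    have h1 := hfact (g := diagTorus c 1) (h := 1) (by rw [hc]; simp [chiTheta]) x
    rw [hF, act_one] at h1
    rw [← h1]
    simp
  rw [hFsum]
  refine Submodule.sum_mem _ fun k hk => ?_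
  by_cases hak : a ∣ k
  · obtain ⟨m, rfl⟩ := hak
    refine Submodule.mem_iSup_of_mem (-m) ⟨⟨_, fun x => rfl⟩, fun g x => ?_⟩
    obtain ⟨r, hr⟩ := exists_units_zpow_eq ha (chiTheta θ g)
    rw [chiTheta_zsmul, ← hr, ← zpow_neg, neg_neg, ← zpow_mul]
    exact hFact g r hr _ hk x
  · obtain ⟨ζ, hζa, hζk⟩ := exists_units_zpow_eq_one_zpow_ne_one (K := K) ha hak
    have : F k = 0 := by
      funext x
      have h1 := hFact 1 ζ (by rw [hζa]; simp [chiTheta]) k hk x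
      rw [act_one] at h1
      by_contra h0
      exact hζk (Units.ext (mul_right_cancel₀ h0 (by rw [Units.val_one, one_mul, ← h1])))
    rw [this]
    exact Submodule.zero_mem _

end Decomposition

/-- **Statement 16.** Let `A = KQ/⟨R⟩` be a bound quiver algebra, `d` a dimension
vector and `θ` an integral weight whose induced character `χ_θ` of `GL(d)` is
nontrivial (equivalently, `θ` is nonzero on the support of `d`).  Let `C` be a
`θ`-semistable, `GL(d)`-invariant, irreducible, closed subvariety of `rep(A,d)`.
Then `K[C]^{G_θ} = ⊕_{n ≥ 0} SI(C)_{nθ}` (the invariant functions are the internal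
direct sum of the semi-invariants of weights `nθ`, `n ≥ 0`); in particular
`SI(C)_{nθ} = 0` for every integer `n < 0`. -/
theorem invariantFns_eq_directSum_SI {K : Type} [Field K] [IsAlgClosed K] [CharZero K]
    (Q : QuiverData) (R : RelSet Q K) (hadm : IsAdmissible Q K R)
    (d : Q.V → ℕ) (θ : Q.V → ℤ) (hθ : ∃ v : Q.V, d v ≠ 0 ∧ θ v ≠ 0)
    (C : Set (RepSpace K Q d)) (hCrep : C ⊆ RepSet K Q R d)
    (hC : ∀ g M, M ∈ C → glAct g M ∈ C)
    (hCirr : @IsIrreducible _ (repTopology K Q d) C)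
    (hCcl : @IsClosed _ (repTopology K Q d) C)
    (hss : ∃ M ∈ C, IsThetaSemistable θ M) :
    (⨆ n : ℕ, SIwt C hC ((n : ℤ) • θ)) = invariantFns C hC θ ∧
      iSupIndep (fun n : ℕ => SIwt C hC ((n : ℤ) • θ)) ∧
      ∀ n : ℤ, n < 0 → SIwt C hC (n • θ) = ⊥ := by
  have hneg (n : ℤ) (hn : n < 0) : SIwt C hC (n • θ) = ⊥ :=
    SIwt_zsmul_eq_bot hadm hθ hCrep hC hCirr hss hn
  refine ⟨le_antisymm (iSup_le fun n => SIwt_zsmul_le_invariantFns hC θ n) ?_,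
    iSupIndep_SIwt hC hθ, hneg⟩
  refine (invariantFns_le_iSup_SIwt hC hθ).trans (iSup_le fun n => ?_)
  rcases lt_or_ge n 0 with hn | hn
  · rw [hneg n hn]
    exact bot_le
  · lift n to ℕ using hn
    exact le_iSup (fun n : ℕ => SIwt C hC ((n : ℤ) • θ)) n
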